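/- Let ν be a probability measure on [0,1] and let a_n = ∫₀¹ tⁿ dν(t). Then for every k ≥ 0 the k-th term of the n-th iterate T^{∘n}((a_j)_j) converges to m_k as n → ∞. -/

import Mathlib

open MeasureTheory Set Filter

/-- The fixed point sequence. -/
noncomputable def fpSeq : ℕ → ℝ
  | 0 => 1
  | n + 1 => (-1 + Real.sqrt (1 + 4 * fpSeq n ^ 2)) / (2 * fpSeq n)

/-- The transformation `T` on sequences: `T(a)ₙ = (a₀ + ⋯ + aₙ)⁻¹`. -/
noncomputable def Tmap (a : ℕ → ℝ) : ℕ → ℝ :=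
  fun n => (∑ j ∈ Finset.range (n + 1), a j)⁻¹

theorem fpSeq_pos (n : ℕ) : 0 < fpSeq n := by
  induction n with
  | zero => simp [fpSeq]
  | succ n ih =>
    rw [fpSeq]
    have h : 1 < Real.sqrt (1 + 4 * fpSeq n ^ 2) := by
      rw [Real.lt_sqrt zero_le_one]
      nlinarith [pow_pos ih 2]
    exact div_pos (by linarith) (by linarith)

/-- The defining quadratic equation of the recursion. -/
theorem fpSeq_succ_quadratic (n : ℕ) :
    fpSeq n * fpSeq (n + 1) ^ 2 + fpSeq (n + 1) = fpSeq n := by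
  have hpos := fpSeq_pos n
  have hsq : Real.sqrt (1 + 4 * fpSeq n ^ 2) ^ 2 = 1 + 4 * fpSeq n ^ 2 :=
    Real.sq_sqrt (by positivity)
  rw [fpSeq]
  generalize Real.sqrt (1 + 4 * fpSeq n ^ 2) = r at hsq ⊢
  field_simp
  linear_combination hsq

/-- `fpSeq` is a fixed point of `Tmap`. -/
theorem sum_fpSeq_mul_fpSeq (n : ℕ) :
    (∑ j ∈ Finset.range (n + 1), fpSeq j) * fpSeq n = 1 := by
  induction n with
  | zero => simp [fpSeq]
  | succ n ih =>
    rw [Finset.sum_range_succ]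
    refine mul_left_cancel₀ (fpSeq_pos n).ne' ?_
    linear_combination fpSeq (n + 1) * ih + fpSeq_succ_quadratic n

theorem fpSeq_succ_lt_one (n : ℕ) : fpSeq (n + 1) < 1 := by
  have hpos := fpSeq_pos n
  have hquad := fpSeq_succ_quadratic n
  by_contra! h
  have hle : fpSeq n * 1 ≤ fpSeq n * fpSeq (n + 1) ^ 2 :=
    mul_le_mul_of_nonneg_left (one_le_pow₀ h) hpos.le
  linarith

/-- A nonnegative sequence contracted at each step up to a vanishing perturbation tends to `0`. -/
theorem tendsto_zero_of_le_mul_add {e d : ℕ → ℝ} {q : ℝ} (hq : 0 ≤ q) (hq1 : q < 1)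
    (he : ∀ n, 0 ≤ e n) (hd : Tendsto d atTop (nhds 0))
    (h : ∀ n, e (n + 1) ≤ q * (e n + d n)) : Tendsto e atTop (nhds 0) := by
  refine tendsto_order.2 ⟨fun b hb => Eventually.of_forall fun n => hb.trans_le (he n),
    fun ε hε => ?_⟩
  have hδ : 0 < (1 - q) * (ε / 2) := mul_pos (by linarith) (by linarith)
  obtain ⟨N, hN⟩ := eventually_atTop.1 (hd.eventually_lt_const hδ)
  have hbound : ∀ i, e (N + i) ≤ q ^ i * e N + ε / 2 := by
    intro i
    induction i with
    | zero => simp; linarith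
    | succ i ih =>
      calc e (N + i + 1) ≤ q * (e (N + i) + d (N + i)) := h _
        _ ≤ q * (q ^ i * e N + ε / 2) + (1 - q) * (ε / 2) := by
            nlinarith [mul_le_mul_of_nonneg_left ih hq,
              mul_le_mul_of_nonneg_left (hN (N + i) (by omega)).le hq]
        _ = q ^ (i + 1) * e N + ε / 2 := by ring
  have hpow : Tendsto (fun i => q ^ i * e N) atTop (nhds 0) := by
    simpa using (tendsto_pow_atTop_nhds_zero_of_lt_one hq hq1).mul_const (e N)
  obtain ⟨M, hM⟩ := eventually_atTop.1 (hpow.eventually_lt_const (half_pos hε))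
  refine eventually_atTop.2 ⟨N + M, fun n hn => ?_⟩
  obtain ⟨i, rfl⟩ := Nat.exists_eq_add_of_le (show N ≤ n by omega)
  linarith [hbound i, hM i (by omega)]

theorem one_le_sum_range_succ {b : ℕ → ℝ} (h0 : b 0 = 1) (hb : ∀ j, 0 ≤ b j) (k : ℕ) :
    1 ≤ ∑ j ∈ Finset.range (k + 1), b j :=
  h0 ▸ Finset.single_le_sum (fun j _ => hb j) (Finset.mem_range.2 k.succ_pos)

theorem iterate_Tmap_zero_and_nonneg {a : ℕ → ℝ} (h0 : a 0 = 1) (ha : ∀ j, 0 ≤ a j) (n : ℕ) :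
    Tmap^[n] a 0 = 1 ∧ ∀ j, 0 ≤ Tmap^[n] a j := by
  induction n with
  | zero => exact ⟨h0, ha⟩
  | succ n ih =>
    rw [Function.iterate_succ_apply']
    exact ⟨by simp [Tmap, ih.1],
      fun j => inv_nonneg.2 (Finset.sum_nonneg fun i _ => ih.2 i)⟩

/-- The iterates of `Tmap` on any nonnegative sequence starting at `1` converge termwise. -/
theorem tendsto_iterate_Tmap {a : ℕ → ℝ} (h0 : a 0 = 1) (ha : ∀ j, 0 ≤ a j) (k : ℕ) :
    Tendsto (fun n => Tmap^[n] a k) atTop (nhds (fpSeq k)) := by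
  induction k using Nat.strong_induction_on with
  | _ k ih =>
  have hiter := iterate_Tmap_zero_and_nonneg h0 ha
  rcases k with _ | k
  · simp [hiter, fpSeq]
  have hsum : Tendsto (fun n => ∑ j ∈ Finset.range (k + 1), Tmap^[n] a j) atTop
      (nhds (∑ j ∈ Finset.range (k + 1), fpSeq j)) :=
    tendsto_finsetSum _ fun j hj => ih j (Finset.mem_range.1 hj)
  rw [tendsto_iff_dist_tendsto_zero] at hsum ⊢
  refine tendsto_zero_of_le_mul_add (fpSeq_pos (k + 1)).le (fpSeq_succ_lt_one k)
    (fun n => dist_nonneg) hsum fun n => ?_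
  have hone := one_le_sum_range_succ (hiter n).1 (hiter n).2 (k + 1)
  have hfix := sum_fpSeq_mul_fpSeq (k + 1)
  simp only [Function.iterate_succ_apply', Tmap, Real.dist_eq]
  rw [Finset.sum_range_succ] at hfix hone ⊢
  set S := ∑ j ∈ Finset.range (k + 1), Tmap^[n] a j
  set s := ∑ j ∈ Finset.range (k + 1), fpSeq j
  set x := Tmap^[n] a (k + 1)
  set m := fpSeq (k + 1)
  have hm : 0 < m := fpSeq_pos (k + 1)
  have hSx : 0 < S + x := one_pos.trans_le hone
  have hdiff : (S + x)⁻¹ - m = m * (S + x)⁻¹ * -((x - m) + (S - s)) := by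
    field_simp
    linear_combination -hfix
  rw [hdiff, abs_mul, abs_neg, abs_of_pos (by positivity)]
  refine mul_le_mul ?_ (abs_add_le _ _) (abs_nonneg _) hm.le
  exact mul_le_of_le_one_right hm.le (inv_le_one_of_one_le₀ hone)

theorem stmt_7 (ν : Measure ℝ) [IsProbabilityMeasure ν]
    (hsupp : ν (Set.Icc (0:ℝ) 1)ᶜ = 0)
    (a : ℕ → ℝ) (ha : ∀ n : ℕ, a n = ∫ t in Set.Icc (0:ℝ) 1, t ^ n ∂ν) :
    ∀ k : ℕ, Tendsto (fun n : ℕ => Tmap^[n] a k) atTop (nhds (fpSeq k)) := by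
  have hIcc : ν (Set.Icc (0 : ℝ) 1) = 1 := (prob_compl_eq_zero_iff measurableSet_Icc).1 hsupp
  refine tendsto_iterate_Tmap ?_ fun j => ?_
  · simp [ha, Measure.real, hIcc]
  · rw [ha]
    exact setIntegral_nonneg measurableSet_Icc fun t ht => pow_nonneg ht.1 j
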